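/- arXiv:2105.00276 — 3 statements merged into one kernel-verified Lean document; each statement's English description precedes it below -/
import Mathlib

section
/- Integer case of the paper's Lemma on boundary values: For every Schwartz function φ : ℝ → ℂ, every nonnegative integer n, and each sign σ ∈ {+1, −1}, lim_{ε→0⁺} ∫_ℝ φ(x)·(ε + σ·i·x)^{−n−1} dx = ((σ·i)^n / n!) · ( π·(−1)^n·φ^{(n)}(0) − σ·i·(−1)^n· lim_{ε→0⁺} ∫_{|x|>ε} φ^{(n)}(x)/x dx ), where φ^{(n)} denotes the n-th derivative of φ. -/
open MeasureTheory Filter Real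

/-- The symmetric difference quotient of a Schwartz function is integrable. -/
theorem SchwartzMap.integrable_sub_comp_neg_div (ψ : SchwartzMap ℝ ℂ) :
    Integrable (fun x : ℝ => (ψ x - ψ (-x)) / (x : ℂ)) := by
  obtain ⟨N, -, hN⟩ := ψ.decay 1 0
  obtain ⟨M, -, hM⟩ := (SchwartzMap.derivCLM ℂ ℂ ψ).decay 0 0
  simp only [norm_iteratedFDeriv_zero, pow_one, pow_zero, one_mul,
    SchwartzMap.derivCLM_apply] at hN hM
  refine (integrable_inv_one_add_sq.const_mul (2 * M + 2 * N)).mono' ?_ ?_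
  · exact (((ψ.continuous.sub (ψ.continuous.comp continuous_neg)).measurable).div
      Complex.measurable_ofReal).aestronglyMeasurable
  · filter_upwards [compl_mem_ae_iff.mpr (measure_singleton (0 : ℝ))] with x hx
    have hx0 : 0 < |x| := abs_pos.mpr hx
    have hlip : ‖ψ x - ψ (-x)‖ ≤ M * (2 * |x|) := by
      have h := Convex.norm_image_sub_le_of_norm_deriv_le (s := Set.univ) (f := ψ) (x := -x) (y := x)
        (fun y _ => ψ.differentiableAt) (fun y _ => hM y) convex_univ trivial trivial
      rwa [sub_neg_eq_add, ← two_mul, norm_mul, Real.norm_eq_abs, Real.norm_eq_abs, abs_two] at h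
    have hdecay : |x| * ‖ψ x - ψ (-x)‖ ≤ 2 * N := by
      have h₁ := hN x
      have h₂ := hN (-x)
      rw [norm_neg] at h₂
      rw [Real.norm_eq_abs] at h₁ h₂
      nlinarith [norm_sub_le (ψ x) (ψ (-x))]
    rw [norm_div, Complex.norm_real, Real.norm_eq_abs, ← div_eq_mul_inv,
      div_le_div_iff₀ hx0 (by positivity), ← sq_abs x]
    nlinarith

/-- Odd kernels `k ε` approximating `1 / x` recover half the integral of the symmetric difference
quotient of a Schwartz function. -/
theorem SchwartzMap.tendsto_integral_odd_kernel (ψ : SchwartzMap ℝ ℂ) (k : ℝ → ℝ → ℝ)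
    (hmeas : ∀ ε, Measurable (k ε)) (hodd : ∀ ε x, k ε (-x) = -k ε x)
    (hbdd : ∀ ε, 0 < ε → ∀ x, |k ε x| ≤ ε⁻¹) (hle : ∀ ε x, |k ε x * x| ≤ 1)
    (hlim : ∀ x, x ≠ 0 → Tendsto (fun ε => k ε x) (nhdsWithin 0 (Set.Ioi 0)) (nhds x⁻¹)) :
    Tendsto (fun ε => ∫ x : ℝ, (k ε x : ℂ) * ψ x) (nhdsWithin 0 (Set.Ioi 0))
      (nhds (2⁻¹ * ∫ x : ℝ, (ψ x - ψ (-x)) / (x : ℂ))) := by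
  have hne : ∀ᵐ x : ℝ, x ≠ 0 := compl_mem_ae_iff.mpr (measure_singleton (0 : ℝ))
  have hsymm : ∀ᶠ ε in nhdsWithin (0 : ℝ) (Set.Ioi 0),
      2⁻¹ * ∫ x : ℝ, ((k ε x * x : ℝ) : ℂ) * ((ψ x - ψ (-x)) / (x : ℂ)) =
        ∫ x : ℝ, (k ε x : ℂ) * ψ x := by
    filter_upwards [self_mem_nhdsWithin] with ε hε
    have hint : Integrable (fun x : ℝ => (k ε x : ℂ) * ψ x) :=
      ψ.integrable.bdd_mul (c := ε⁻¹)
        (Complex.measurable_ofReal.comp (hmeas ε)).aestronglyMeasurable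
        (.of_forall fun x => by simpa using hbdd ε hε x)
    have hflip := integral_neg_eq_self (fun x : ℝ => (k ε x : ℂ) * ψ x) volume
    have hcongr : ∫ x : ℝ, ((k ε x * x : ℝ) : ℂ) * ((ψ x - ψ (-x)) / (x : ℂ)) =
        ∫ x : ℝ, ((k ε x : ℂ) * ψ x + (k ε (-x) : ℂ) * ψ (-x)) := by
      refine integral_congr_ae ?_
      filter_upwards [hne] with x hx
      have hx' : (x : ℂ) ≠ 0 := by exact_mod_cast hx
      rw [hodd]
      push_cast
      field_simp
      ring
    rw [hcongr, integral_add hint hint.comp_neg, hflip]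
    ring
  refine Tendsto.congr' hsymm (Tendsto.const_mul _ ?_)
  refine tendsto_integral_filter_of_dominated_convergence
    (fun x => ‖(ψ x - ψ (-x)) / (x : ℂ)‖) (.of_forall fun ε => ?_) (.of_forall fun ε => ?_)
    ψ.integrable_sub_comp_neg_div.norm ?_
  · exact (Complex.measurable_ofReal.comp
      ((hmeas ε).mul measurable_id)).aestronglyMeasurable.mul
      ψ.integrable_sub_comp_neg_div.aestronglyMeasurable
  · refine .of_forall fun x => ?_
    rw [norm_mul, Complex.norm_real, Real.norm_eq_abs]
    exact mul_le_of_le_one_left (norm_nonneg _) (hle ε x)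
  · filter_upwards [hne] with x hx
    have h := (hlim x hx).mul_const x
    rw [inv_mul_cancel₀ hx] at h
    simpa using ((Complex.continuous_ofReal.tendsto _).comp h).mul_const
      ((ψ x - ψ (-x)) / (x : ℂ))

/-- The principal value of `1 / x` on a Schwartz function. -/
theorem SchwartzMap.tendsto_principal_value (ψ : SchwartzMap ℝ ℂ) :
    Tendsto (fun ε : ℝ => ∫ x in {x : ℝ | ε < |x|}, ψ x / (x : ℂ)) (nhdsWithin 0 (Set.Ioi 0))
      (nhds (2⁻¹ * ∫ x : ℝ, (ψ x - ψ (-x)) / (x : ℂ))) := by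
  have hset : ∀ ε : ℝ, MeasurableSet {x : ℝ | ε < |x|} := fun ε =>
    measurableSet_lt measurable_const continuous_abs.measurable
  refine (ψ.tendsto_integral_odd_kernel (fun ε => {x : ℝ | ε < |x|}.indicator fun x => x⁻¹)
    (fun ε => measurable_inv.indicator (hset ε)) ?_ ?_ ?_ ?_).congr fun ε => ?_
  · intro ε x
    by_cases h : ε < |x| <;> simp [Set.indicator, h, inv_neg]
  · intro ε hε x
    by_cases h : ε < |x|
    · simpa [Set.indicator, h, abs_inv] using inv_anti₀ hε h.le
    · simpa [Set.indicator, h] using hε.le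
  · intro ε x
    by_cases h : ε < |x| <;> by_cases hx : x = 0 <;> simp [Set.indicator, h, hx]
  · intro x hx
    refine tendsto_const_nhds.congr' ?_
    filter_upwards [nhdsWithin_le_nhds (Iio_mem_nhds (abs_pos.mpr hx))] with ε hε
    simp [Set.indicator, Set.mem_Iio.mp hε]
  · rw [← integral_indicator (hset ε)]
    congr 1 with x
    by_cases h : ε < |x| <;> simp [Set.indicator, h, div_eq_inv_mul]

/-- The conjugate Poisson kernel converges to the principal value of `1 / x`. -/
theorem SchwartzMap.tendsto_integral_conj_poisson (ψ : SchwartzMap ℝ ℂ) :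
    Tendsto (fun ε : ℝ => ∫ x : ℝ, ((x / (ε ^ 2 + x ^ 2) : ℝ) : ℂ) * ψ x)
      (nhdsWithin 0 (Set.Ioi 0)) (nhds (2⁻¹ * ∫ x : ℝ, (ψ x - ψ (-x)) / (x : ℂ))) := by
  refine ψ.tendsto_integral_odd_kernel (fun ε x => x / (ε ^ 2 + x ^ 2)) (fun ε => ?_) ?_ ?_ ?_ ?_
  · fun_prop
  · intro ε x
    rw [neg_sq, neg_div]
  · intro ε hε x
    rw [abs_div, abs_of_pos (by positivity : 0 < ε ^ 2 + x ^ 2), inv_eq_one_div,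
      div_le_div_iff₀ (by positivity) hε, ← sq_abs x]
    nlinarith [sq_nonneg (|x| - ε), abs_nonneg x]
  · intro ε x
    rw [div_mul_eq_mul_div, ← sq, abs_of_nonneg (by positivity)]
    exact div_le_one_of_le₀ (by nlinarith [sq_nonneg ε]) (by positivity)
  · intro x hx
    have h : ContinuousAt (fun ε : ℝ => x / (ε ^ 2 + x ^ 2)) 0 :=
      ContinuousAt.div (by fun_prop) (by fun_prop) (by simpa using hx)
    have h₀ : x / ((0 : ℝ) ^ 2 + x ^ 2) = x⁻¹ := by
      field_simp
      ring
    exact h₀ ▸ h.tendsto.mono_left nhdsWithin_le_nhds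

/-- The Poisson kernel is an approximate identity of mass `π`. -/
theorem SchwartzMap.tendsto_integral_poisson (ψ : SchwartzMap ℝ ℂ) :
    Tendsto (fun ε : ℝ => ∫ x : ℝ, ((ε / (ε ^ 2 + x ^ 2) : ℝ) : ℂ) * ψ x)
      (nhdsWithin 0 (Set.Ioi 0)) (nhds ((π : ℂ) * ψ 0)) := by
  have hscale : ∀ᶠ ε in nhdsWithin (0 : ℝ) (Set.Ioi 0),
      ∫ t : ℝ, (((1 + t ^ 2)⁻¹ : ℝ) : ℂ) * ψ (ε * t) =
        ∫ x : ℝ, ((ε / (ε ^ 2 + x ^ 2) : ℝ) : ℂ) * ψ x := by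
    filter_upwards [self_mem_nhdsWithin] with ε hε
    have hε : 0 < ε := hε
    have h := Measure.integral_comp_mul_left
      (fun x : ℝ => (ε : ℂ) * (((ε / (ε ^ 2 + x ^ 2) : ℝ) : ℂ) * ψ x)) ε
    rw [integral_const_mul, integral_const_mul, abs_of_pos (inv_pos.mpr hε), Complex.real_smul,
      ← mul_assoc, ← Complex.ofReal_mul, inv_mul_cancel₀ hε.ne', Complex.ofReal_one, one_mul] at h
    rw [← h, ← integral_const_mul]
    congr 1 with t
    rw [← mul_assoc, ← Complex.ofReal_mul]
    congr 2
    field_simp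
  have hlim : (π : ℂ) * ψ 0 = ∫ t : ℝ, (((1 + t ^ 2)⁻¹ : ℝ) : ℂ) * ψ 0 := by
    rw [integral_mul_const, integral_complex_ofReal, integral_univ_inv_one_add_sq]
  rw [hlim]
  refine Tendsto.congr' hscale ?_
  obtain ⟨C, -, hC⟩ := ψ.decay 0 0
  simp only [norm_iteratedFDeriv_zero, pow_zero, one_mul] at hC
  refine tendsto_integral_filter_of_dominated_convergence (fun t => (1 + t ^ 2)⁻¹ * C)
    (.of_forall fun ε => ?_) (.of_forall fun ε => .of_forall fun t => ?_)
    (integrable_inv_one_add_sq.mul_const C) (.of_forall fun t => ?_)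
  · have := ψ.continuous.measurable
    exact Measurable.aestronglyMeasurable (by fun_prop)
  · rw [norm_mul, Complex.norm_real, Real.norm_of_nonneg (by positivity)]
    exact mul_le_mul_of_nonneg_left (hC _) (by positivity)
  · have h : Continuous fun ε : ℝ => (((1 + t ^ 2)⁻¹ : ℝ) : ℂ) * ψ (ε * t) :=
      continuous_const.mul (ψ.continuous.comp (by fun_prop))
    simpa using (h.tendsto 0).mono_left nhdsWithin_le_nhds

/-- The number `ε + i σ x` has norm at least `ε`. -/
theorem le_norm_add_mul_I_mul (ε σ x : ℝ) :
    ε ≤ ‖(ε : ℂ) + (σ : ℂ) * Complex.I * (x : ℂ)‖ := by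
  simpa using Complex.re_le_norm ((ε : ℂ) + (σ : ℂ) * Complex.I * (x : ℂ))

/-- For `ε > 0`, the number `ε + i σ x` does not vanish. -/
theorem add_mul_I_mul_ne_zero {ε : ℝ} (hε : 0 < ε) (σ x : ℝ) :
    (ε : ℂ) + (σ : ℂ) * Complex.I * (x : ℂ) ≠ 0 :=
  norm_pos_iff.mp (hε.trans_le (le_norm_add_mul_I_mul ε σ x))

theorem SchwartzMap.integrable_mul_inv_pow (ψ : SchwartzMap ℝ ℂ) {ε : ℝ} (hε : 0 < ε) (σ : ℝ)
    (m : ℕ) :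
    Integrable fun x : ℝ => ψ x * (((ε : ℂ) + (σ : ℂ) * Complex.I * (x : ℂ)) ^ m)⁻¹ := by
  refine ψ.integrable.mul_bdd (c := (ε ^ m)⁻¹) ?_ (.of_forall fun x => ?_)
  · exact Measurable.aestronglyMeasurable (by fun_prop)
  · rw [norm_inv, norm_pow]
    exact inv_anti₀ (by positivity) (pow_le_pow_left₀ hε.le (le_norm_add_mul_I_mul ε σ x) m)

/-- Integration by parts lowers the order of the pole by one. -/
theorem SchwartzMap.integral_div_pow_succ_succ (φ : SchwartzMap ℝ ℂ) {ε σ : ℝ} (hε : 0 < ε)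
    (hσ : σ ≠ 0) (n : ℕ) :
    ∫ x : ℝ, φ x / ((ε : ℂ) + (σ : ℂ) * Complex.I * (x : ℂ)) ^ (n + 1 + 1) =
      ((n + 1 : ℂ) * ((σ : ℂ) * Complex.I))⁻¹ *
        ∫ x : ℝ, SchwartzMap.derivCLM ℂ ℂ φ x /
          ((ε : ℂ) + (σ : ℂ) * Complex.I * (x : ℂ)) ^ (n + 1) := by
  set c : ℂ := (σ : ℂ) * Complex.I
  have hc0 : c ≠ 0 := mul_ne_zero (by exact_mod_cast hσ) Complex.I_ne_zero
  have hn0 : (n + 1 : ℂ) ≠ 0 := by exact_mod_cast n.succ_ne_zero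
  have hpole : ∀ x : ℝ, (ε : ℂ) + c * (x : ℂ) ≠ 0 := add_mul_I_mul_ne_zero hε σ
  have hderiv : ∀ x : ℝ, HasDerivAt (fun x : ℝ => (((ε : ℂ) + c * (x : ℂ)) ^ (n + 1))⁻¹)
      (-((n + 1 : ℂ) * c) * (((ε : ℂ) + c * (x : ℂ)) ^ (n + 1 + 1))⁻¹) x := by
    intro x
    have h₁ : HasDerivAt (fun x : ℝ => (ε : ℂ) + c * (x : ℂ)) c x := by
      simpa using ((Complex.ofRealCLM.hasDerivAt (x := x)).const_mul c).const_add (ε : ℂ)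
    refine ((h₁.pow (n + 1)).inv (pow_ne_zero _ (hpole x))).congr_deriv ?_
    have := hpole x
    simp only [Nat.add_sub_cancel, Nat.cast_add, Nat.cast_one, Pi.pow_apply]
    field_simp
    ring
  have hparts := integral_mul_deriv_eq_deriv_mul_of_integrable (u := φ)
    (u' := SchwartzMap.derivCLM ℂ ℂ φ)
    (fun x _ => by simpa using φ.differentiableAt.hasDerivAt) (fun x _ => hderiv x)
    (by
      refine ((φ.integrable_mul_inv_pow hε σ (n + 1 + 1)).const_mul
        (-((n + 1 : ℂ) * c))).congr (.of_forall fun x => ?_)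
      simp only [Pi.mul_apply]
      ring)
    ((SchwartzMap.derivCLM ℂ ℂ φ).integrable_mul_inv_pow hε σ (n + 1))
    (φ.integrable_mul_inv_pow hε σ (n + 1))
  simp only [mul_left_comm (φ _), integral_const_mul] at hparts
  simp only [div_eq_mul_inv]
  rw [neg_mul, neg_inj] at hparts
  rw [← hparts, inv_mul_cancel_left₀ (mul_ne_zero hn0 hc0)]

/-- Repeated integration by parts reduces a pole of order `n + 1` to a simple one. -/
theorem SchwartzMap.exists_iteratedDeriv_integral_div_pow (n : ℕ) {σ : ℝ} (hσ : σ ≠ 0)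
    (φ : SchwartzMap ℝ ℂ) :
    ∃ ψ : SchwartzMap ℝ ℂ, (iteratedDeriv n fun y : ℝ => φ y) = ψ ∧ ∀ ε : ℝ, 0 < ε →
      ∫ x : ℝ, φ x / ((ε : ℂ) + (σ : ℂ) * Complex.I * (x : ℂ)) ^ (n + 1) =
        ((n.factorial : ℂ) * ((σ : ℂ) * Complex.I) ^ n)⁻¹ *
          ∫ x : ℝ, ψ x / ((ε : ℂ) + (σ : ℂ) * Complex.I * (x : ℂ)) := by
  induction n generalizing φ with
  | zero => exact ⟨φ, by simp, fun ε _ => by simp⟩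
  | succ n ih =>
    obtain ⟨ψ, hψ, hint⟩ := ih (SchwartzMap.derivCLM ℂ ℂ φ)
    refine ⟨ψ, ?_, fun ε hε => ?_⟩
    · rw [iteratedDeriv_succ', ← hψ]
      congr 1
    · rw [φ.integral_div_pow_succ_succ hε hσ, hint ε hε, ← mul_assoc, ← mul_inv,
        Nat.factorial_succ, pow_succ]
      congr 2
      push_cast
      ring

/-- The Sokhotski–Plemelj formula for a simple pole. -/
theorem SchwartzMap.tendsto_integral_div_add_mul_I (ψ : SchwartzMap ℝ ℂ) {σ : ℝ}
    (hσ : σ ^ 2 = 1) :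
    Tendsto (fun ε : ℝ => ∫ x : ℝ, ψ x / ((ε : ℂ) + (σ : ℂ) * Complex.I * (x : ℂ)))
      (nhdsWithin 0 (Set.Ioi 0))
      (nhds ((π : ℂ) * ψ 0 - (σ : ℂ) * Complex.I *
        (2⁻¹ * ∫ x : ℝ, (ψ x - ψ (-x)) / (x : ℂ)))) := by
  refine Tendsto.congr' ?_ (ψ.tendsto_integral_poisson.sub
    (ψ.tendsto_integral_conj_poisson.const_mul ((σ : ℂ) * Complex.I)))
  filter_upwards [self_mem_nhdsWithin] with ε hε
  have hε : 0 < ε := hε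
  have hbound : ∀ y x : ℝ, y ^ 2 ≤ ε ^ 2 + x ^ 2 →
      ‖((y / (ε ^ 2 + x ^ 2) : ℝ) : ℂ)‖ ≤ ε⁻¹ := by
    intro y x hy
    rw [Complex.norm_real, Real.norm_eq_abs, abs_div,
      abs_of_pos (by positivity : 0 < ε ^ 2 + x ^ 2), inv_eq_one_div,
      div_le_div_iff₀ (by positivity) hε]
    nlinarith [sq_nonneg (|y| - ε), sq_abs y, sq_nonneg x]
  have hpoisson : Integrable fun x : ℝ => ((ε / (ε ^ 2 + x ^ 2) : ℝ) : ℂ) * ψ x :=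
    ψ.integrable.bdd_mul (c := ε⁻¹) (Measurable.aestronglyMeasurable (by fun_prop))
      (.of_forall fun x => hbound ε x (by nlinarith))
  have hconj : Integrable fun x : ℝ => ((x / (ε ^ 2 + x ^ 2) : ℝ) : ℂ) * ψ x :=
    ψ.integrable.bdd_mul (c := ε⁻¹) (Measurable.aestronglyMeasurable (by fun_prop))
      (.of_forall fun x => hbound x x (by nlinarith))
  rw [← integral_const_mul, ← integral_sub hpoisson (hconj.const_mul _)]
  congr 1 with x
  have hpole := add_mul_I_mul_ne_zero hε σ x
  have hden : (ε : ℂ) ^ 2 + (x : ℂ) ^ 2 ≠ 0 := by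
    exact_mod_cast (by positivity : 0 < ε ^ 2 + x ^ 2).ne'
  have hσc : (σ : ℂ) ^ 2 = 1 := by exact_mod_cast hσ
  push_cast
  rw [eq_div_iff hpole]
  field_simp
  linear_combination (-(x : ℂ) ^ 2 * (σ : ℂ) ^ 2 * ψ x) * Complex.I_sq + (x : ℂ) ^ 2 * ψ x * hσc

/-- Integer case of the boundary-value lemma: for every Schwartz `φ`, `n ∈ ℕ`, sign `σ ∈ {1,-1}`,
`lim_{ε→0⁺} ∫ φ(x)·(ε+σix)^{-n-1} dx
  = ((σi)^n/n!)·(π·(-1)^n·φ^{(n)}(0) − σi·(-1)^n·Vp(1/x)[φ^{(n)}])`. -/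
theorem boundary_value_integer_case (φ : SchwartzMap ℝ ℂ) (n : ℕ) (σ : ℝ)
    (hσ : σ = 1 ∨ σ = -1) :
    ∃ pv : ℂ,
      Tendsto
        (fun ε : ℝ => ∫ x in {x : ℝ | ε < |x|},
          iteratedDeriv n (fun y : ℝ => φ y) x / (x : ℂ))
        (nhdsWithin 0 (Set.Ioi 0)) (nhds pv) ∧
      Tendsto
        (fun ε : ℝ => ∫ x : ℝ, φ x / ((ε : ℂ) + (σ : ℂ) * Complex.I * (x : ℂ)) ^ (n + 1))
        (nhdsWithin 0 (Set.Ioi 0))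
        (nhds ((((σ : ℂ) * Complex.I) ^ n / (n.factorial : ℂ)) *
          ((π : ℂ) * (-1 : ℂ) ^ n * iteratedDeriv n (fun y : ℝ => φ y) 0
            - (σ : ℂ) * Complex.I * (-1 : ℂ) ^ n * pv))) := by
  have hσ2 : σ ^ 2 = 1 := by
    rcases hσ with rfl | rfl <;> norm_num
  have hσ0 : σ ≠ 0 := by
    rintro rfl
    norm_num at hσ2
  obtain ⟨ψ, hψ, hint⟩ := φ.exists_iteratedDeriv_integral_div_pow n hσ0
  rw [hψ]
  refine ⟨_, ψ.tendsto_principal_value, ?_⟩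
  have hsq : ((σ : ℂ) * Complex.I) ^ n * ((σ : ℂ) * Complex.I) ^ n = (-1) ^ n := by
    rw [← mul_pow, ← sq, mul_pow, Complex.I_sq, ← Complex.ofReal_pow, hσ2, Complex.ofReal_one,
      one_mul]
  have hcoeff : ((n.factorial : ℂ) * ((σ : ℂ) * Complex.I) ^ n)⁻¹ =
      ((σ : ℂ) * Complex.I) ^ n / (n.factorial : ℂ) * (-1) ^ n := by
    have hfact : (n.factorial : ℂ) ≠ 0 := by exact_mod_cast n.factorial_ne_zero
    have hone : ((-1 : ℂ) ^ n) * (-1) ^ n = 1 := by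
      rw [← mul_pow]
      norm_num
    refine inv_eq_of_mul_eq_one_right ?_
    field_simp
    rw [sq, hsq, hone]
  refine Tendsto.congr' ?_ (((ψ.tendsto_integral_div_add_mul_I hσ2).const_mul
    ((n.factorial : ℂ) * ((σ : ℂ) * Complex.I) ^ n)⁻¹).trans (le_of_eq ?_))
  · filter_upwards [self_mem_nhdsWithin] with ε hε
    exact (hint ε hε).symm
  · rw [hcoeff]
    congr 1
    ring
end

section
/- Distributional Fourier transform of x^α for −1 < α < 0: Let α ∈ (−1, 0) and let φ : ℝ → ℂ be a Schwartz function with Fourier transform φ̂(k) = ∫_ℝ φ(x)e^{−ikx}dx. Define x^α for negative x by the branch with log(−1) = −iπ, i.e. x^α := e^{−iπα}|x|^α for x < 0. Then both integrals below converge absolutely and ∫_ℝ x^α · φ̂(x) dx = Γ(α+1) · ∫_ℝ ( e^{−iπα}·(−ix)^{−α−1} + (ix)^{−α−1} ) · φ(x) dx, where (±ix)^{−α−1} denotes the principal complex power of the nonzero purely imaginary number ±ix (x ≠ 0). -/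
open MeasureTheory Real

/-- The Fourier transform `φ̂(k) = ∫ φ(x) e^{−ikx} dx` of a Schwartz function. -/
noncomputable def fourierT (φ : SchwartzMap ℝ ℂ) (k : ℝ) : ℂ :=
  ∫ x : ℝ, φ x * Complex.exp (-Complex.I * (k : ℂ) * (x : ℂ))

/-- The fractional power `x^α` on the real line with the branch convention `log(−1) = −iπ`. -/
noncomputable def branchPow (α : ℝ) (x : ℝ) : ℂ :=
  if x < 0 then Complex.exp (-(π : ℂ) * Complex.I * (α : ℂ)) * ((|x| ^ α : ℝ) : ℂ)
  else ((x ^ α : ℝ) : ℂ)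


section

open Complex Set Filter Topology

/-- A bounded integrable function stays integrable after multiplication by `|x| ^ β`,
`-1 < β ≤ 0`. -/
lemma integrable_abs_rpow_mul {β : ℝ} (hβ : -1 < β) (hβ0 : β ≤ 0) {f : ℝ → ℂ} {C : ℝ}
    (hf : Integrable f) (hC : ∀ x, ‖f x‖ ≤ C) :
    Integrable (fun x : ℝ => ((|x| ^ β : ℝ) : ℂ) * f x) := by
  have hm : AEStronglyMeasurable (fun x : ℝ => ((|x| ^ β : ℝ) : ℂ) * f x) :=
    (by fun_prop : Measurable fun x : ℝ => ((|x| ^ β : ℝ) : ℂ)).aestronglyMeasurable.mul hf.1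
  have h_near : IntegrableOn (fun x : ℝ => ((|x| ^ β : ℝ) : ℂ) * f x) (Metric.ball 0 1) := by
    refine integrableOn_ball_of_norm_le_rpow (C := C) (α := -β) (by simp) (by simp; linarith)
      (.of_forall fun x => ?_) hm
    rw [norm_mul, norm_real, Real.norm_of_nonneg (by positivity), neg_neg, Real.norm_eq_abs,
      mul_comm]
    gcongr
    exact hC x
  have h_far : IntegrableOn (fun x : ℝ => ((|x| ^ β : ℝ) : ℂ) * f x) (Metric.ball 0 1)ᶜ := by
    refine Integrable.mono hf.integrableOn hm.restrict ?_
    filter_upwards [ae_restrict_mem measurableSet_ball.compl] with x hx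
    have hx' : 1 ≤ |x| := by simpa using hx
    rw [norm_mul, norm_real, Real.norm_of_nonneg (by positivity)]
    exact mul_le_of_le_one_left (norm_nonneg _) (Real.rpow_le_one_of_one_le_of_nonpos hx' hβ0)
  rw [← integrableOn_univ, ← union_compl_self (Metric.ball (0 : ℝ) 1)]
  exact h_near.union h_far

lemma integrableOn_rpow_mul_exp_neg_mul {α b : ℝ} (hα : -1 < α) (hb : 0 < b) :
    IntegrableOn (fun k : ℝ => k ^ α * Real.exp (-b * k)) (Ioi 0) := by
  simpa using integrableOn_rpow_mul_exp_neg_mul_rpow hα one_pos hb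

lemma norm_rpow_mul_cexp_neg_mul {α k : ℝ} (hk : 0 < k) (r : ℂ) :
    ‖((k ^ α : ℝ) : ℂ) * cexp (-r * k)‖ = k ^ α * Real.exp (-r.re * k) := by
  rw [norm_mul, norm_real, Real.norm_of_nonneg (by positivity), norm_exp]
  simp

lemma aestronglyMeasurable_rpow_mul_cexp_neg_mul (α : ℝ) (r : ℂ) (μ : Measure ℝ) :
    AEStronglyMeasurable (fun k : ℝ => ((k ^ α : ℝ) : ℂ) * cexp (-r * k)) μ :=
  Measurable.aestronglyMeasurable (by fun_prop)

lemma integrableOn_rpow_mul_cexp_neg_mul {α : ℝ} (hα : -1 < α) {r : ℂ} (hr : 0 < r.re) :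
    IntegrableOn (fun k : ℝ => ((k ^ α : ℝ) : ℂ) * cexp (-r * k)) (Ioi 0) := by
  refine (integrableOn_rpow_mul_exp_neg_mul hα hr).mono'
    (aestronglyMeasurable_rpow_mul_cexp_neg_mul α r _) ?_
  filter_upwards [ae_restrict_mem measurableSet_Ioi] with k hk
  exact (norm_rpow_mul_cexp_neg_mul hk r).le

lemma differentiableAt_integral_rpow_mul_cexp_neg_mul {α : ℝ} (hα : -1 < α) {r : ℂ}
    (hr : 0 < r.re) :
    DifferentiableAt ℂ
      (fun r : ℂ => ∫ k : ℝ in Ioi 0, ((k ^ α : ℝ) : ℂ) * cexp (-r * k)) r := by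
  have hs : {z : ℂ | r.re / 2 < z.re} ∈ 𝓝 r :=
    (isOpen_lt continuous_const continuous_re).mem_nhds (by simp; linarith)
  refine (hasDerivAt_integral_of_dominated_loc_of_deriv_le
    (F' := fun (z : ℂ) (k : ℝ) => ((k ^ α : ℝ) : ℂ) * (cexp (-z * k) * (-k)))
    (bound := fun k => k ^ (α + 1) * Real.exp (-(r.re / 2) * k)) hs
    (.of_forall fun z => aestronglyMeasurable_rpow_mul_cexp_neg_mul α z _)
    (integrableOn_rpow_mul_cexp_neg_mul hα hr)
    (Measurable.aestronglyMeasurable (by fun_prop)) ?_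
    (integrableOn_rpow_mul_exp_neg_mul (by linarith) (by linarith)) ?_).2.differentiableAt
  · filter_upwards [ae_restrict_mem measurableSet_Ioi] with k hk z hz
    have hk : 0 < k := hk
    have hz : r.re / 2 < z.re := hz
    rw [← mul_assoc, norm_mul, norm_rpow_mul_cexp_neg_mul hk, norm_neg, norm_real,
      Real.norm_of_nonneg hk.le, Real.rpow_add_one hk.ne', mul_right_comm]
    gcongr
  · filter_upwards with k z _
    have := ((hasDerivAt_id z).neg.mul_const (k : ℂ)).cexp.const_mul ((k ^ α : ℝ) : ℂ)
    simpa using this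

/-- Euler's integral for `Γ(α + 1)`, rescaled by a complex number with positive real part. -/
lemma integral_rpow_mul_cexp_neg_mul {α : ℝ} (hα : -1 < α) {r : ℂ} (hr : 0 < r.re) :
    ∫ k : ℝ in Ioi 0, ((k ^ α : ℝ) : ℂ) * cexp (-r * k) =
      Real.Gamma (α + 1) * r ^ ((-α - 1 : ℝ) : ℂ) := by
  have hU : IsOpen {z : ℂ | 0 < z.re} := isOpen_lt continuous_const continuous_re
  have hF : AnalyticOnNhd ℂ
      (fun r : ℂ => ∫ k : ℝ in Ioi 0, ((k ^ α : ℝ) : ℂ) * cexp (-r * k)) {z | 0 < z.re} :=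
    DifferentiableOn.analyticOnNhd (fun z hz =>
      (differentiableAt_integral_rpow_mul_cexp_neg_mul hα hz).differentiableWithinAt) hU
  have hG : AnalyticOnNhd ℂ
      (fun r : ℂ => Real.Gamma (α + 1) * r ^ ((-α - 1 : ℝ) : ℂ)) {z | 0 < z.re} :=
    DifferentiableOn.analyticOnNhd (fun z hz =>
      ((differentiableAt_id.cpow_const (Or.inl hz)).const_mul _).differentiableWithinAt) hU
  refine hF.eqOn_of_preconnected_of_frequently_eq hG (convex_halfSpace_re_gt 0).isPreconnected
    (z₀ := 1) (by simp) ?_ hr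
  have h_tendsto : Tendsto ((↑) : ℝ → ℂ) (𝓝[≠] 1) (𝓝[≠] 1) := by
    refine tendsto_nhdsWithin_of_tendsto_nhds_of_eventually_within _ ?_ ?_
    · exact (continuous_ofReal.tendsto' 1 1 (by simp)).mono_left nhdsWithin_le_nhds
    · filter_upwards [self_mem_nhdsWithin] with t ht
      simpa using ht
  refine h_tendsto.frequently (Eventually.frequently ?_)
  filter_upwards [nhdsWithin_le_nhds (Ioi_mem_nhds one_pos)] with t ht
  have ht : 0 < t := ht
  have h := Real.integral_rpow_mul_exp_neg_mul_Ioi (a := α + 1) (by linarith) ht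
  rw [← ofReal_cpow ht.le, ← ofReal_mul]
  calc _ = ∫ k : ℝ in Ioi 0, ((k ^ (α + 1 - 1) * Real.exp (-(t * k)) : ℝ) : ℂ) := by
        simp
    _ = _ := by
        rw [integral_complex_ofReal, h, one_div, Real.inv_rpow ht.le, ← Real.rpow_neg ht.le, mul_comm]
        ring_nf

lemma norm_cexp_neg_I_mul_mul (k x : ℝ) : ‖cexp (-I * k * x)‖ = 1 := by
  rw [norm_exp]
  simp

/-- Fubini for the exponentially damped fractional power against a Fourier transform. -/
lemma integral_rpow_mul_cexp_mul_fourier {α ε : ℝ} (hα : -1 < α) (hε : 0 < ε) {f : ℝ → ℂ}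
    (hf : Integrable f) :
    ∫ k : ℝ in Ioi 0, ((k ^ α : ℝ) : ℂ) * cexp (-ε * k) * ∫ x : ℝ, f x * cexp (-I * k * x) =
      Real.Gamma (α + 1) * ∫ x : ℝ, (ε + I * x) ^ ((-α - 1 : ℝ) : ℂ) * f x := by
  have h_int : Integrable (Function.uncurry fun k x : ℝ =>
      ((k ^ α : ℝ) : ℂ) * cexp (-ε * k) * (f x * cexp (-I * k * x)))
      ((volume.restrict (Ioi 0)).prod volume) := by
    have h := (integrableOn_rpow_mul_cexp_neg_mul hα (r := ε) (by simpa)).mul_prod hf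
    refine (h.mul_bdd (g := fun p : ℝ × ℝ => cexp (-I * p.1 * p.2)) (c := 1)
      (Continuous.aestronglyMeasurable (by fun_prop))
      (.of_forall fun p => (norm_cexp_neg_I_mul_mul p.1 p.2).le)).congr (.of_forall fun p => ?_)
    simp only [Function.uncurry]
    ring
  simp_rw [← integral_const_mul]
  rw [integral_integral_swap h_int]
  refine integral_congr_ae (.of_forall fun x => ?_)
  have h := integral_rpow_mul_cexp_neg_mul hα (r := ε + I * x) (by simpa)
  dsimp only
  rw [← mul_assoc, ← h, ← integral_mul_const]
  refine integral_congr_ae (.of_forall fun k => ?_)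
  dsimp only
  rw [mul_mul_mul_comm, ← Complex.exp_add, mul_right_comm]
  ring_nf

lemma norm_add_I_mul_cpow_le {β : ℝ} (hβ : β ≤ 0) (ε : ℝ) {x : ℝ} (hx : x ≠ 0) :
    ‖((ε : ℂ) + I * x) ^ (β : ℂ)‖ ≤ |x| ^ β := by
  rw [norm_cpow_real]
  refine Real.rpow_le_rpow_of_nonpos (abs_pos.mpr hx) ?_ hβ
  simpa using abs_im_le_norm ((ε : ℂ) + I * x)

lemma aestronglyMeasurable_add_I_mul_cpow (ε β : ℝ) :
    AEStronglyMeasurable (fun x : ℝ => ((ε : ℂ) + I * x) ^ (β : ℂ)) :=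
  Measurable.aestronglyMeasurable (by fun_prop)

/-- Pairing `k ^ α` on the half-line with a Fourier transform. -/
lemma integral_rpow_mul_fourier {α : ℝ} (hα : -1 < α) {f : ℝ → ℂ} (hf : Integrable f)
    (hf' : Integrable fun x : ℝ => ((|x| ^ (-α - 1) : ℝ) : ℂ) * f x)
    (hF : IntegrableOn
      (fun k : ℝ => ((k ^ α : ℝ) : ℂ) * ∫ x : ℝ, f x * cexp (-I * k * x)) (Ioi 0)) :
    ∫ k : ℝ in Ioi 0, ((k ^ α : ℝ) : ℂ) * ∫ x : ℝ, f x * cexp (-I * k * x) =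
      Real.Gamma (α + 1) * ∫ x : ℝ, (I * x) ^ ((-α - 1 : ℝ) : ℂ) * f x := by
  have h_left : Tendsto (fun ε : ℝ => ∫ k : ℝ in Ioi 0,
      ((k ^ α : ℝ) : ℂ) * cexp (-ε * k) * ∫ x : ℝ, f x * cexp (-I * k * x)) (𝓝[>] 0)
      (𝓝 (∫ k : ℝ in Ioi 0, ((k ^ α : ℝ) : ℂ) * ∫ x : ℝ, f x * cexp (-I * k * x))) := by
    refine tendsto_integral_filter_of_dominated_convergence _
      (.of_forall fun ε => ?_) ?_ hF.norm (.of_forall fun k => ?_)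
    · refine (hF.1.mul (Continuous.aestronglyMeasurable
        (by fun_prop : Continuous fun k : ℝ => cexp (-ε * k)))).congr (.of_forall fun k => ?_)
      exact mul_right_comm _ _ _
    · filter_upwards [self_mem_nhdsWithin] with ε hε
      filter_upwards [ae_restrict_mem measurableSet_Ioi] with k hk
      rw [mul_right_comm, norm_mul]
      refine mul_le_of_le_one_right (norm_nonneg _) ?_
      rw [norm_exp, Real.exp_le_one_iff]
      simpa using (mul_pos hε hk).le
    · refine Tendsto.mul_const _ ?_
      refine Tendsto.mono_left (Continuous.tendsto' (by fun_prop) _ _ (by simp))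
        nhdsWithin_le_nhds
  have h_right : Tendsto (fun ε : ℝ => ∫ x : ℝ, ((ε : ℂ) + I * x) ^ ((-α - 1 : ℝ) : ℂ) * f x)
      (𝓝[>] 0) (𝓝 (∫ x : ℝ, (I * x) ^ ((-α - 1 : ℝ) : ℂ) * f x)) := by
    refine tendsto_integral_filter_of_dominated_convergence _
      (.of_forall fun ε => (aestronglyMeasurable_add_I_mul_cpow ε _).mul hf.1)
      (.of_forall fun ε => ?_) hf'.norm ?_
    · filter_upwards [Measure.ae_ne volume 0] with x hx
      rw [norm_mul, norm_mul, norm_real, Real.norm_of_nonneg (by positivity)]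
      gcongr
      exact norm_add_I_mul_cpow_le (by linarith) ε hx
    · filter_upwards [Measure.ae_ne volume 0] with x hx
      refine Tendsto.mul_const _ (Tendsto.mono_left ?_ nhdsWithin_le_nhds)
      refine Tendsto.cpow (Continuous.tendsto' (by fun_prop) _ _ (by simp)) tendsto_const_nhds ?_
      exact Or.inr (by simpa using hx)
  refine tendsto_nhds_unique h_left ((h_right.const_mul _).congr' ?_)
  filter_upwards [self_mem_nhdsWithin] with ε hε
  exact (integral_rpow_mul_cexp_mul_fourier hα hε hf).symm

lemma integrable_I_mul_cpow_mul {β : ℝ} {f : ℝ → ℂ} (hf : Integrable f)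
    (hf' : Integrable fun x : ℝ => ((|x| ^ β : ℝ) : ℂ) * f x) :
    Integrable fun x : ℝ => (I * x) ^ (β : ℂ) * f x := by
  have hm := (aestronglyMeasurable_add_I_mul_cpow 0 β).mul hf.1
  simp only [ofReal_zero, zero_add] at hm
  refine hf'.mono hm (.of_forall fun x => le_of_eq ?_)
  rw [norm_mul, norm_mul, norm_real, Real.norm_of_nonneg (by positivity), norm_cpow_real]
  simp

open FourierTransform in
lemma fourierT_eq_fourier (φ : SchwartzMap ℝ ℂ) (k : ℝ) :
    fourierT φ k = (𝓕 φ) (k / (2 * π)) := by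
  rw [SchwartzMap.fourier_coe, Real.fourier_real_eq_integral_exp_smul, fourierT]
  refine integral_congr_ae (.of_forall fun x => ?_)
  have hπ : (π : ℂ) ≠ 0 := ofReal_ne_zero.mpr Real.pi_ne_zero
  dsimp only
  rw [smul_eq_mul, mul_comm]
  congr 2
  push_cast
  field_simp

lemma integrable_fourierT (φ : SchwartzMap ℝ ℂ) : Integrable (fourierT φ) := by
  rw [funext (fourierT_eq_fourier φ)]
  exact (SchwartzMap.integrable _).comp_div (by positivity)

lemma norm_fourierT_le (φ : SchwartzMap ℝ ℂ) (k : ℝ) : ‖fourierT φ k‖ ≤ ∫ x : ℝ, ‖φ x‖ := by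
  refine (norm_integral_le_integral_norm _).trans_eq ?_
  simp only [norm_mul, norm_cexp_neg_I_mul_mul, mul_one]

lemma integrable_abs_rpow_mul_fourierT {α : ℝ} (hα : -1 < α) (hα0 : α ≤ 0)
    (φ : SchwartzMap ℝ ℂ) :
    Integrable fun k : ℝ => ((|k| ^ α : ℝ) : ℂ) * fourierT φ k :=
  integrable_abs_rpow_mul hα hα0 (integrable_fourierT φ) (norm_fourierT_le φ)

lemma integrable_abs_rpow_mul_schwartz {β : ℝ} (hβ : -1 < β) (hβ0 : β ≤ 0)
    (φ : SchwartzMap ℝ ℂ) :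
    Integrable fun x : ℝ => ((|x| ^ β : ℝ) : ℂ) * φ x :=
  integrable_abs_rpow_mul hβ hβ0 φ.integrable fun x => φ.norm_le_seminorm ℝ x

lemma integral_Ioi_rpow_mul_fourierT {α : ℝ} (hα : -1 < α) (hα0 : α < 0)
    (φ : SchwartzMap ℝ ℂ) :
    ∫ k : ℝ in Ioi 0, ((k ^ α : ℝ) : ℂ) * fourierT φ k =
      Real.Gamma (α + 1) * ∫ x : ℝ, (I * x) ^ ((-α - 1 : ℝ) : ℂ) * φ x := by
  refine integral_rpow_mul_fourier hα φ.integrable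
    (integrable_abs_rpow_mul_schwartz (by linarith) (by linarith) φ) ?_
  refine (integrable_abs_rpow_mul_fourierT hα hα0.le φ).integrableOn.congr_fun (fun k hk => ?_)
    measurableSet_Ioi
  dsimp only
  rw [abs_of_pos hk, fourierT]

/-- The reflection `x ↦ φ (-x)` of a Schwartz function. -/
noncomputable def schwartzReflection (φ : SchwartzMap ℝ ℂ) : SchwartzMap ℝ ℂ :=
  SchwartzMap.compCLMOfContinuousLinearEquiv ℝ (ContinuousLinearEquiv.neg ℝ) φ

lemma schwartzReflection_apply (φ : SchwartzMap ℝ ℂ) (x : ℝ) :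
    schwartzReflection φ x = φ (-x) := rfl

lemma fourierT_schwartzReflection (φ : SchwartzMap ℝ ℂ) (k : ℝ) :
    fourierT (schwartzReflection φ) k = fourierT φ (-k) := by
  rw [fourierT, fourierT, ← integral_neg_eq_self]
  simp [schwartzReflection_apply]

lemma integral_Iio_abs_rpow_mul_fourierT {α : ℝ} (hα : -1 < α) (hα0 : α < 0)
    (φ : SchwartzMap ℝ ℂ) :
    ∫ k : ℝ in Iio 0, ((|k| ^ α : ℝ) : ℂ) * fourierT φ k =
      Real.Gamma (α + 1) * ∫ x : ℝ, (-I * x) ^ ((-α - 1 : ℝ) : ℂ) * φ x := by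
  have h := integral_Ioi_rpow_mul_fourierT hα hα0 (schwartzReflection φ)
  rw [← integral_neg_eq_self (fun x : ℝ => (I * x) ^ ((-α - 1 : ℝ) : ℂ) * _)] at h
  simp only [schwartzReflection_apply, fourierT_schwartzReflection, neg_neg, ofReal_neg,
    mul_neg, ← neg_mul] at h
  rw [← h, ← integral_Iic_eq_integral_Iio, ← neg_zero, ← integral_comp_neg_Ioi, neg_zero]
  refine setIntegral_congr_fun measurableSet_Ioi fun k hk => ?_
  rw [abs_neg, abs_of_pos hk]

lemma integrable_neg_I_mul_cpow_mul {β : ℝ} (hβ : -1 < β) (hβ0 : β ≤ 0)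
    (φ : SchwartzMap ℝ ℂ) :
    Integrable fun x : ℝ => (-I * x) ^ (β : ℂ) * φ x := by
  have h := (integrable_I_mul_cpow_mul (schwartzReflection φ).integrable
    (integrable_abs_rpow_mul_schwartz hβ hβ0 _)).comp_neg
  simpa [schwartzReflection_apply] using h

end

/-- Distributional Fourier transform of `x^α` for `−1 < α < 0`:
`∫ x^α φ̂(x) dx = Γ(α+1) ∫ (e^{−iπα}(−ix)^{−α−1} + (ix)^{−α−1}) φ(x) dx`,
both integrals converging absolutely. -/
theorem fourier_transform_fractional_power (α : ℝ) (hα : α ∈ Set.Ioo (-1 : ℝ) 0)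
    (φ : SchwartzMap ℝ ℂ) :
    Integrable (fun x : ℝ => branchPow α x * fourierT φ x) ∧
    Integrable (fun x : ℝ =>
      (Complex.exp (-(π : ℂ) * Complex.I * (α : ℂ)) *
          (-Complex.I * (x : ℂ)) ^ ((-α - 1 : ℝ) : ℂ) +
        (Complex.I * (x : ℂ)) ^ ((-α - 1 : ℝ) : ℂ)) * φ x) ∧
    ∫ x : ℝ, branchPow α x * fourierT φ x =
      (Real.Gamma (α + 1) : ℂ) *
        ∫ x : ℝ,
          (Complex.exp (-(π : ℂ) * Complex.I * (α : ℂ)) *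
              (-Complex.I * (x : ℂ)) ^ ((-α - 1 : ℝ) : ℂ) +
            (Complex.I * (x : ℂ)) ^ ((-α - 1 : ℝ) : ℂ)) * φ x := by
  obtain ⟨hα1, hα0⟩ := hα
  have h_neg : ∀ x ∈ Set.Iio (0 : ℝ), Complex.exp (-(π : ℂ) * Complex.I * (α : ℂ)) *
      (((|x| ^ α : ℝ) : ℂ) * fourierT φ x) = branchPow α x * fourierT φ x := fun x hx => by
    rw [branchPow, if_pos (Set.mem_Iio.mp hx), mul_assoc (Complex.exp _)]
  have h_nonneg : ∀ x ∈ Set.Ici (0 : ℝ),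
      ((|x| ^ α : ℝ) : ℂ) * fourierT φ x = branchPow α x * fourierT φ x := fun x hx => by
    rw [branchPow, if_neg (not_lt.mpr hx), abs_of_nonneg hx]
  have h_abs := integrable_abs_rpow_mul_fourierT hα1 hα0.le φ
  have h_int_neg := IntegrableOn.congr_fun (h_abs.const_mul _).integrableOn h_neg measurableSet_Iio
  have h_int_nonneg := h_abs.integrableOn.congr_fun h_nonneg measurableSet_Ici
  have h_int : Integrable fun x : ℝ => branchPow α x * fourierT φ x := by
    rw [← integrableOn_univ, ← Set.Iio_union_Ici (a := (0 : ℝ))]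
    exact h_int_neg.union h_int_nonneg
  have h_minus := (integrable_neg_I_mul_cpow_mul (β := -α - 1) (by linarith) (by linarith)
    φ).const_mul (Complex.exp (-(π : ℂ) * Complex.I * (α : ℂ)))
  have h_plus := integrable_I_mul_cpow_mul (β := -α - 1) φ.integrable
    (integrable_abs_rpow_mul_schwartz (by linarith) (by linarith) φ)
  simp only [add_mul, mul_assoc (Complex.exp _)]
  refine ⟨h_int, h_minus.add h_plus, ?_⟩
  rw [integral_add h_minus h_plus, integral_const_mul,
    ← setIntegral_univ, ← Set.Iio_union_Ici (a := (0 : ℝ)),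
    setIntegral_union (Set.Iio_disjoint_Ici le_rfl) measurableSet_Ici h_int_neg h_int_nonneg,
    ← setIntegral_congr_fun measurableSet_Iio h_neg, integral_const_mul,
    integral_Iio_abs_rpow_mul_fourierT hα1 hα0, integral_Ici_eq_integral_Ioi, mul_add,
    mul_left_comm, ← integral_Ioi_rpow_mul_fourierT hα1 hα0]
  congr 1
  refine setIntegral_congr_fun measurableSet_Ioi fun x hx => ?_
  rw [branchPow, if_neg (not_lt.mpr (le_of_lt hx))]
end

section
/- Distributional Fourier transform of the Bose–Einstein function: Let β > 0 and let φ : ℝ → ℂ be a Schwartz function with Fourier transform φ̂(k) = ∫_ℝ φ(x)e^{−ikx}dx. Then lim_{ε→0⁺} ∫_{|x|>ε} φ̂(x)/(e^{βx} − 1) dx = −π·φ(0) + lim_{ε→0⁺} ∫_{|x|>ε} ( (π/(iβ))·coth(πx/β) ) · φ(x) dx, and in particular both principal-value limits exist. -/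
open MeasureTheory Filter Real

open Set Topology

/-- The real hyperbolic cotangent. -/
noncomputable def realCoth (t : ℝ) : ℝ := Real.cosh t / Real.sinh t

lemma measurable_realCoth : Measurable realCoth :=
  Real.measurable_cosh.div Real.measurable_sinh

lemma realCoth_neg (t : ℝ) : realCoth (-t) = -realCoth t := by
  simp [realCoth, div_neg]

lemma realCoth_eq_one_add {t : ℝ} (ht : t ≠ 0) :
    realCoth t = 1 + 2 / (Real.exp (2 * t) - 1) := by
  have hs : Real.exp (2 * t) - 1 ≠ 0 := by
    rw [sub_ne_zero]
    simpa using ht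
  have h2 : Real.exp (2 * t) = Real.exp t * Real.exp t := by
    rw [← Real.exp_add]; ring_nf
  rw [h2] at hs ⊢
  have he := (Real.exp_pos t).ne'
  rw [realCoth, Real.cosh_eq, Real.sinh_eq, Real.exp_neg]
  have h3 : Real.exp t - (Real.exp t)⁻¹ ≠ 0 := by
    intro h
    apply hs
    field_simp at h
    linarith
  have h4 : Real.exp t ^ 2 - 1 ≠ 0 := by rwa [sq]
  field_simp
  ring

lemma one_le_realCoth {t : ℝ} (ht : 0 < t) : 1 ≤ realCoth t := by
  rw [realCoth_eq_one_add ht.ne']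
  have : 0 < Real.exp (2 * t) - 1 := by
    have := Real.add_one_lt_exp (x := 2 * t) (by positivity)
    linarith
  have : 0 < 2 / (Real.exp (2 * t) - 1) := by positivity
  linarith

lemma realCoth_le {t : ℝ} (ht : 0 < t) : realCoth t ≤ 1 + t⁻¹ := by
  rw [realCoth_eq_one_add ht.ne']
  have h : 2 * t ≤ Real.exp (2 * t) - 1 := by
    linarith [Real.add_one_le_exp (2 * t)]
  have : 2 / (Real.exp (2 * t) - 1) ≤ 2 / (2 * t) := by gcongr
  have e : 2 / (2 * t) = t⁻¹ := by field_simp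
  linarith

lemma abs_realCoth_le {t : ℝ} (ht : t ≠ 0) : |realCoth t| ≤ 1 + |t|⁻¹ := by
  have key : ∀ s : ℝ, 0 < s → |realCoth s| ≤ 1 + |s|⁻¹ := fun s hs => by
    rw [abs_of_pos (by linarith [one_le_realCoth hs]), abs_of_pos hs]
    exact realCoth_le hs
  rcases lt_or_gt_of_ne ht with h | h
  · have := key (-t) (by linarith)
    rwa [realCoth_neg, abs_neg, abs_neg] at this
  · exact key t h

/-- Geometric expansion of the hyperbolic cotangent. -/
lemma hasSum_exp_realCoth {a x : ℝ} (ha : 0 < a) (hx : 0 < x) :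
    HasSum (fun n : ℕ => Real.exp (-((n + 1) * a) * x)) ((realCoth (a * x / 2) - 1) / 2) := by
  have hlt : Real.exp (-(a * x)) < 1 := by
    rw [Real.exp_lt_one_iff]
    have := mul_pos ha hx
    linarith
  have h := (hasSum_geometric_of_lt_one (Real.exp_pos (-(a * x))).le hlt).mul_left
    (Real.exp (-(a * x)))
  convert! h using 1
  · funext n
    rw [← Real.exp_nat_mul, ← Real.exp_add]
    ring_nf
  · have hax := mul_pos ha hx
    rw [realCoth_eq_one_add (by positivity), Real.exp_neg]
    have e : 2 * (a * x / 2) = a * x := by ring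
    rw [e]
    have h1 : 0 < Real.exp (a * x) - 1 := by
      linarith [Real.add_one_lt_exp hax.ne']
    have h2 : 1 - (Real.exp (a * x))⁻¹ ≠ 0 := by
      rw [Real.exp_neg] at hlt
      linarith
    have h3 := (Real.exp_pos (a * x)).ne'
    field_simp
    ring

/-- Mittag-Leffler expansion of the hyperbolic cotangent. -/
lemma hasSum_div_sq_add_sq_realCoth {b y : ℝ} (hb : 0 < b) (hy : 0 < y) :
    HasSum (fun n : ℕ => y / (((n + 1) * b) ^ 2 + y ^ 2))
      ((π / b * realCoth (π * y / b) - y⁻¹) / 2) := by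
  set z : ℂ := Complex.I * (y / b : ℝ) with hz
  have hyb : 0 < y / b := by positivity
  have hmem : z ∈ Complex.integerComplement :=
    UpperHalfPlane.coe_mem_integerComplement ⟨z, by simpa [hz] using hyb⟩
  have hs := (summable_cotTerm hmem).hasSum
  have ht : ∑' n : ℕ, cotTerm z n = π * Complex.cot (π * z) - 1 / z :=
    (cot_series_rep' hmem).symm
  rw [ht] at hs
  have h := hs.mul_left (Complex.I / (2 * b))
  rw [← Complex.hasSum_ofReal]
  convert! h using 1
  · funext n
    rw [cotTerm_identity hmem, hz]
    have hbC : (b : ℂ) ≠ 0 := by exact_mod_cast hb.ne'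
    have h1 : (((n + 1) * b) ^ 2 + y ^ 2 : ℂ) ≠ 0 := by
      have : ((n + 1) * b) ^ 2 + y ^ 2 ≠ 0 := by positivity
      exact_mod_cast this
    have h2 : (Complex.I * (y / b : ℝ) + (n + 1)) * (Complex.I * (y / b : ℝ) - (n + 1)) =
        -(((n + 1) * b) ^ 2 + y ^ 2) / (b : ℂ) ^ 2 := by
      push_cast
      field_simp
      linear_combination (y : ℂ) ^ 2 * Complex.I_sq
    rw [h2]
    push_cast
    field_simp
    rw [Complex.I_sq]
    ring
  · have hbC : (b : ℂ) ≠ 0 := by exact_mod_cast hb.ne'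
    have hyC : (y : ℂ) ≠ 0 := by exact_mod_cast hy.ne'
    have hsC : Complex.sinh ((π * y / b : ℝ) : ℂ) ≠ 0 := by
      rw [← Complex.ofReal_sinh]
      have : 0 < Real.sinh (π * y / b) := Real.sinh_pos_iff.2 (by positivity)
      exact_mod_cast this.ne'
    have e : (π : ℂ) * z = ((π * y / b : ℝ) : ℂ) * Complex.I := by
      rw [hz]; push_cast; ring
    rw [e, Complex.cot, Complex.cos_mul_I, Complex.sin_mul_I, hz, realCoth]
    push_cast at hsC ⊢
    generalize Complex.sinh (π * y / b) = s at *
    field_simp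

namespace SchwartzMap

lemma exists_norm_sub_comp_neg_le (ψ : SchwartzMap ℝ ℂ) :
    ∃ C : ℝ, 0 ≤ C ∧ ∀ x : ℝ, ‖ψ x - ψ (-x)‖ ≤ C * |x| := by
  refine ⟨2 * SchwartzMap.seminorm ℝ 0 0 (derivCLM ℝ ℂ ψ), by positivity, fun x => ?_⟩
  have h := convex_univ.norm_image_sub_le_of_norm_deriv_le (𝕜 := ℝ) (f := ψ)
    (C := SchwartzMap.seminorm ℝ 0 0 (derivCLM ℝ ℂ ψ)) (x := -x) (y := x)
    (fun y _ => ψ.differentiableAt)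
    (fun y _ => by
      rw [← derivCLM_apply ℝ]
      exact norm_le_seminorm ℝ _ y) (mem_univ _) (mem_univ _)
  have e : ‖x - -x‖ = 2 * |x| := by
    rw [sub_neg_eq_add, ← two_mul, norm_mul]
    simp
  rw [e] at h
  linarith

lemma integrable_comp_neg (ψ : SchwartzMap ℝ ℂ) : Integrable (fun x => ψ (-x)) :=
  ψ.integrable.comp_neg

lemma integrable_sub_comp_neg (ψ : SchwartzMap ℝ ℂ) : Integrable (fun x => ψ x - ψ (-x)) :=
  ψ.integrable.sub ψ.integrable_comp_neg

lemma integrableOn_inv_mul_sub_comp_neg (ψ : SchwartzMap ℝ ℂ) :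
    IntegrableOn (fun x : ℝ => ((x⁻¹ : ℝ) : ℂ) * (ψ x - ψ (-x))) (Ioi 0) := by
  have hm : Measurable (fun x : ℝ => ((x⁻¹ : ℝ) : ℂ)) :=
    Complex.measurable_ofReal.comp measurable_inv
  have hc : Continuous (fun x : ℝ => ψ x - ψ (-x)) :=
    ψ.continuous.sub (ψ.continuous.comp continuous_neg)
  rw [← Ioc_union_Ioi_eq_Ioi (zero_le_one (α := ℝ))]
  refine IntegrableOn.union ?_ ?_
  · obtain ⟨C, -, hC⟩ := ψ.exists_norm_sub_comp_neg_le
    refine IntegrableOn.of_bound (by simp) (hm.mul hc.measurable).aestronglyMeasurable C ?_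
    filter_upwards [ae_restrict_mem measurableSet_Ioc] with x hx
    rw [norm_mul, Complex.norm_real, norm_inv, Real.norm_eq_abs]
    have hx0 : 0 < |x| := abs_pos.2 hx.1.ne'
    rw [inv_mul_le_iff₀ hx0, mul_comm]
    exact hC x
  · refine ψ.integrable_sub_comp_neg.integrableOn.bdd_mul (c := 1) hm.aestronglyMeasurable ?_
    filter_upwards [ae_restrict_mem measurableSet_Ioi] with x hx
    have hx : 1 < x := hx
    rw [Complex.norm_real, norm_inv, Real.norm_eq_abs, abs_of_pos (by linarith)]
    exact inv_le_one_of_one_le₀ hx.le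

/-- A kernel with at most a simple pole at the origin is integrable against the odd part of a
Schwartz function. -/
lemma integrableOn_mul_sub_comp_neg (ψ : SchwartzMap ℝ ℂ) {k : ℝ → ℝ} (hk : Measurable k)
    {A B : ℝ} (hkb : ∀ x, 0 < x → |k x| ≤ A + B * x⁻¹) :
    IntegrableOn (fun x : ℝ => (k x : ℂ) * (ψ x - ψ (-x))) (Ioi 0) := by
  have h1 := (ψ.integrable_sub_comp_neg.integrableOn (s := Ioi 0)).norm.const_mul A
  have h2 := ψ.integrableOn_inv_mul_sub_comp_neg.norm.const_mul B
  have hc : Continuous (fun x : ℝ => ψ x - ψ (-x)) :=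
    ψ.continuous.sub (ψ.continuous.comp continuous_neg)
  refine (h1.add h2).mono'
    ((Complex.measurable_ofReal.comp hk).mul hc.measurable).aestronglyMeasurable ?_
  filter_upwards [ae_restrict_mem measurableSet_Ioi] with x hx
  have hx : 0 < x := hx
  have h := mul_le_mul_of_nonneg_right (hkb x hx) (norm_nonneg (ψ x - ψ (-x)))
  simp only [Pi.add_apply, norm_mul, Complex.norm_real, norm_inv, Real.norm_eq_abs,
    abs_of_pos hx]
  linarith

lemma integrableOn_realCoth_mul_sub_comp_neg (ψ : SchwartzMap ℝ ℂ) {c : ℝ} (hc : 0 < c) :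
    IntegrableOn (fun x : ℝ => (realCoth (c * x) : ℂ) * (ψ x - ψ (-x))) (Ioi 0) := by
  refine ψ.integrableOn_mul_sub_comp_neg (A := 1) (B := c⁻¹)
    (measurable_realCoth.comp (measurable_const_mul c)) fun x hx => ?_
  have hcx : 0 < c * x := mul_pos hc hx
  have h := abs_realCoth_le hcx.ne'
  rwa [abs_of_pos hcx, mul_inv] at h

lemma integrableOn_realCoth_mul (ψ : SchwartzMap ℝ ℂ) {c ε : ℝ} (hc : 0 < c) (hε : 0 < ε) :
    IntegrableOn (fun x : ℝ => (realCoth (c * x) : ℂ) * ψ x) {x : ℝ | ε < |x|} := by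
  refine ψ.integrable.integrableOn.bdd_mul (c := 1 + (c * ε)⁻¹)
    (Complex.measurable_ofReal.comp
      (measurable_realCoth.comp (measurable_const_mul c))).aestronglyMeasurable ?_
  filter_upwards [ae_restrict_mem (measurableSet_lt measurable_const measurable_id.abs)] with x hx
  have hx : ε < |x| := hx
  have hx0 : 0 < |x| := hε.trans hx
  rw [Complex.norm_real, Real.norm_eq_abs]
  refine (abs_realCoth_le (mul_ne_zero hc.ne' (abs_pos.1 hx0))).trans ?_
  rw [abs_mul, abs_of_pos hc]
  gcongr

end SchwartzMap

lemma setOf_lt_abs_eq {ε : ℝ} : {x : ℝ | ε < |x|} = Ioi ε ∪ Iio (-ε) := by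
  ext x
  simp [lt_abs, lt_neg]

/-- A principal value at the origin is the integral over the half-line of the symmetrization. -/
lemma tendsto_setIntegral_lt_abs {F : ℝ → ℂ}
    (hF : ∀ ε : ℝ, 0 < ε → IntegrableOn F {x : ℝ | ε < |x|})
    (hS : IntegrableOn (fun x => F x + F (-x)) (Ioi 0)) :
    Tendsto (fun ε : ℝ => ∫ x in {x : ℝ | ε < |x|}, F x) (𝓝[>] 0)
      (𝓝 (∫ x in Ioi 0, (F x + F (-x)))) := by
  have hcov : AECover (volume.restrict (Ioi (0 : ℝ))) (𝓝[>] (0 : ℝ)) fun ε => Ioi ε :=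
    aecover_Ioi_of_Ioi (tendsto_id.mono_left nhdsWithin_le_nhds)
  refine (hcov.integral_tendsto_of_countably_generated hS).congr' ?_
  filter_upwards [self_mem_nhdsWithin] with ε hε
  have hε : 0 < ε := hε
  have hsplit := hF ε hε
  rw [setOf_lt_abs_eq, integrableOn_union] at hsplit
  have hneg : IntegrableOn (fun x => F (-x)) (Ioi ε) := by
    simpa using hsplit.2.comp_neg_Ioi
  rw [Measure.restrict_restrict measurableSet_Ioi,
    inter_eq_left.2 (Ioi_subset_Ioi hε.le), integral_add hsplit.1 hneg, integral_comp_neg_Ioi,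
    integral_Iic_eq_integral_Iio, setOf_lt_abs_eq,
    setIntegral_union _ measurableSet_Iio hsplit.1 hsplit.2]
  rw [Set.disjoint_left]
  intro x hx hx'
  simp only [mem_Ioi, mem_Iio] at hx hx'
  linarith

lemma SchwartzMap.tendsto_setIntegral_realCoth (ψ : SchwartzMap ℝ ℂ) {c : ℝ} (hc : 0 < c) :
    Tendsto (fun ε : ℝ => ∫ x in {x : ℝ | ε < |x|}, (realCoth (c * x) : ℂ) * ψ x) (𝓝[>] 0)
      (𝓝 (∫ x in Ioi 0, (realCoth (c * x) : ℂ) * (ψ x - ψ (-x)))) := by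
  have e : (fun x : ℝ => (realCoth (c * x) : ℂ) * ψ x + (realCoth (c * -x) : ℂ) * ψ (-x)) =
      fun x => (realCoth (c * x) : ℂ) * (ψ x - ψ (-x)) := by
    funext x
    rw [mul_neg, realCoth_neg]
    push_cast
    ring
  have h := tendsto_setIntegral_lt_abs (fun ε hε => ψ.integrableOn_realCoth_mul hc hε)
    (by rw [e]; exact ψ.integrableOn_realCoth_mul_sub_comp_neg hc)
  rwa [e] at h

lemma tendsto_setIntegral_lt_abs_of_integrable {F : ℝ → ℂ} (hF : Integrable F) :
    Tendsto (fun ε : ℝ => ∫ x in {x : ℝ | ε < |x|}, F x) (𝓝[>] 0) (𝓝 (∫ x, F x)) := by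
  have h := tendsto_setIntegral_lt_abs (fun ε _ => hF.integrableOn)
    (hF.add hF.comp_neg).integrableOn
  have e : ∫ x in Ioi 0, (F x + F (-x)) = ∫ x, F x := by
    rw [integral_add hF.integrableOn hF.comp_neg.integrableOn, integral_comp_neg_Ioi, neg_zero,
      add_comm, intervalIntegral.integral_Iic_add_Ioi hF.integrableOn hF.integrableOn]
  rwa [e] at h

/-- The transform `fourierT φ`, as a Schwartz function. -/
noncomputable def fourierTSchwartz (φ : SchwartzMap ℝ ℂ) : SchwartzMap ℝ ℂ :=
  SchwartzMap.compCLMOfContinuousLinearEquiv ℂ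
    (ContinuousLinearEquiv.unitsEquivAut ℝ (Units.mk0 (2 * π)⁻¹ (by positivity)))
    (FourierTransform.fourier φ)

lemma fourierTSchwartz_apply_eq_fourier (φ : SchwartzMap ℝ ℂ) (k : ℝ) :
    fourierTSchwartz φ k = (FourierTransform.fourier φ : SchwartzMap ℝ ℂ) (k / (2 * π)) := by
  simp [fourierTSchwartz, div_eq_mul_inv]

lemma fourierTSchwartz_apply (φ : SchwartzMap ℝ ℂ) (k : ℝ) :
    fourierTSchwartz φ k = fourierT φ k := by
  rw [fourierTSchwartz_apply_eq_fourier, SchwartzMap.fourier_coe,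
    fourier_real_eq_integral_exp_smul, fourierT]
  refine integral_congr_ae (.of_forall fun x => ?_)
  have hpi : (π : ℂ) ≠ 0 := by exact_mod_cast Real.pi_ne_zero
  simp only [smul_eq_mul]
  rw [mul_comm]
  congr 2
  push_cast
  field_simp

/-- Fourier inversion at the origin. -/
lemma integral_fourierTSchwartz (φ : SchwartzMap ℝ ℂ) :
    ∫ k, fourierTSchwartz φ k = 2 * π * φ 0 := by
  simp_rw [fourierTSchwartz_apply_eq_fourier]
  rw [Measure.integral_comp_div
    (fun k => (FourierTransform.fourier φ : SchwartzMap ℝ ℂ) k)]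
  have h : φ 0 = FourierTransformInv.fourierInv
      ((FourierTransform.fourier φ : SchwartzMap ℝ ℂ) : ℝ → ℂ) 0 := by
    rw [← SchwartzMap.fourierInv_coe, FourierTransform.fourierInv_fourier_eq]
  rw [fourierInv_eq'] at h
  simp only [inner_zero_right, mul_zero, Complex.ofReal_zero, zero_mul, Complex.exp_zero,
    one_smul] at h
  rw [h, abs_of_pos (by positivity)]
  simp

lemma integral_exp_mul_fourierT (φ : SchwartzMap ℝ ℂ) {a : ℝ} (ha : 0 < a) (s : ℝ) :
    ∫ x in Ioi (0 : ℝ), (Real.exp (-a * x) : ℂ) * fourierT φ (s * x) =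
      ∫ y, φ y * (a + Complex.I * (s * y))⁻¹ := by
  have hE : IntegrableOn (fun x : ℝ => (Real.exp (-a * x) : ℂ)) (Ioi 0) :=
    (integrableOn_exp_mul_Ioi (neg_lt_zero.2 ha) 0).ofReal
  have hprod : Integrable (Function.uncurry fun x y : ℝ =>
      Complex.exp (-Complex.I * ((s * x : ℝ) : ℂ) * (y : ℂ)) *
        ((Real.exp (-a * x) : ℂ) * φ y))
      ((volume.restrict (Ioi 0)).prod volume) := by
    refine (hE.mul_prod φ.integrable).bdd_mul (c := 1)
      (f := fun p : ℝ × ℝ => Complex.exp (-Complex.I * ((s * p.1 : ℝ) : ℂ) * (p.2 : ℂ)))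
      (by fun_prop) (.of_forall fun p => ?_)
    simp [Complex.norm_exp]
  calc
    _ = ∫ x in Ioi (0 : ℝ), ∫ y : ℝ, Complex.exp (-Complex.I * ((s * x : ℝ) : ℂ) * (y : ℂ)) *
        ((Real.exp (-a * x) : ℂ) * φ y) := by
      refine integral_congr_ae (.of_forall fun x => ?_)
      simp only [fourierT]
      rw [← integral_const_mul]
      refine integral_congr_ae (.of_forall fun y => ?_)
      ring
    _ = ∫ y : ℝ, ∫ x in Ioi (0 : ℝ), Complex.exp (-Complex.I * ((s * x : ℝ) : ℂ) * (y : ℂ)) *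
        ((Real.exp (-a * x) : ℂ) * φ y) := integral_integral_swap hprod
    _ = _ := by
      refine integral_congr_ae (.of_forall fun y => ?_)
      have hre : (-(a + Complex.I * (s * y)) : ℂ).re < 0 := by simpa using ha
      have h := integral_exp_mul_complex_Ioi hre 0
      simp only [Complex.ofReal_zero, mul_zero, Complex.exp_zero, neg_div_neg_eq, one_div] at h
      simp only
      rw [← h, ← integral_const_mul]
      refine integral_congr_ae (.of_forall fun x => ?_)
      simp only
      rw [← mul_assoc, mul_comm _ (φ y), Complex.ofReal_exp, ← Complex.exp_add]
      congr 2
      push_cast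
      ring

/-- The Laplace transform of the odd part of the Fourier transform. -/
lemma integral_exp_mul_fourierT_sub (φ : SchwartzMap ℝ ℂ) {a : ℝ} (ha : 0 < a) :
    ∫ x in Ioi (0 : ℝ), (Real.exp (-a * x) : ℂ) *
        (fourierTSchwartz φ x - fourierTSchwartz φ (-x)) =
      -2 * Complex.I * ∫ y in Ioi (0 : ℝ), ((y / (a ^ 2 + y ^ 2) : ℝ) : ℂ) *
        (φ y - φ (-y)) := by
  have hbd : ∀ x ∈ Ioi (0 : ℝ), ‖(Real.exp (-a * x) : ℂ)‖ ≤ 1 := fun x hx => by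
    have hx : 0 < x := hx
    rw [Complex.norm_real, Real.norm_eq_abs, abs_of_pos (Real.exp_pos _), Real.exp_le_one_iff]
    nlinarith
  have hI : ∀ f : ℝ → ℂ, Integrable f →
      IntegrableOn (fun x => (Real.exp (-a * x) : ℂ) * f x) (Ioi 0) := fun f hf =>
    hf.integrableOn.bdd_mul (c := 1) (by fun_prop)
      ((ae_restrict_mem measurableSet_Ioi).mono hbd)
  have hden : ∀ s y : ℝ, (a + Complex.I * (s * y) : ℂ) ≠ 0 := fun s y h => by
    have := congrArg Complex.re h
    simp at this
    exact ha.ne' this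
  have hJ : ∀ s : ℝ, Integrable fun y : ℝ => φ y * (a + Complex.I * (s * y) : ℂ)⁻¹ := fun s => by
    refine φ.integrable.mul_bdd (c := a⁻¹) (Continuous.aestronglyMeasurable ?_)
      (.of_forall fun y => ?_)
    · exact Continuous.inv₀ (by fun_prop) (hden s)
    · rw [norm_inv]
      gcongr
      have h := Complex.abs_re_le_norm (a + Complex.I * (s * y) : ℂ)
      simpa [abs_of_pos ha] using h
  have h1 := integral_exp_mul_fourierT φ ha 1
  have h2 := integral_exp_mul_fourierT φ ha (-1)
  simp only [← fourierTSchwartz_apply, one_mul, neg_mul] at h1 h2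
  simp only [mul_sub, neg_mul]
  have hI1 := hI _ (fourierTSchwartz φ).integrable
  have hI2 := hI _ (fourierTSchwartz φ).integrable_comp_neg
  have hJ1 := hJ 1
  have hJ2 := hJ (-1)
  simp only [neg_mul] at hI1 hI2
  rw [integral_sub hI1 hI2, h1, h2]
  rw [← integral_sub (by simpa using hJ1) (by simpa using hJ2)]
  set m : ℝ → ℂ := fun y => ((y / (a ^ 2 + y ^ 2) : ℝ) : ℂ) * φ y with hm
  have hpt : ∀ y : ℝ, φ y * ((a : ℂ) + Complex.I * ((1 : ℝ) * y))⁻¹ -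
      φ y * ((a : ℂ) + Complex.I * ((-1 : ℝ) * y))⁻¹ = -2 * Complex.I * m y := fun y => by
    have d1 := hden 1 y
    have d2 := hden (-1) y
    have d3 : (a : ℂ) ^ 2 + (y : ℂ) ^ 2 ≠ 0 := by
      have : a ^ 2 + y ^ 2 ≠ 0 := by positivity
      exact_mod_cast this
    have d4 : ((a : ℂ) + Complex.I * ((1 : ℝ) * y)) * ((a : ℂ) + Complex.I * ((-1 : ℝ) * y)) =
        (a : ℂ) ^ 2 + (y : ℂ) ^ 2 := by
      push_cast
      linear_combination -(y : ℂ) ^ 2 * Complex.I_sq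
    rw [← mul_sub, inv_sub_inv d1 d2, d4, hm]
    push_cast
    ring
  have hmi : Integrable m := by
    have h := ((hJ 1).sub (hJ (-1))).const_mul (Complex.I / 2)
    refine h.congr (.of_forall fun y => ?_)
    simp only [Pi.sub_apply]
    rw [hpt]
    linear_combination -m y * Complex.I_sq
  have hsplit := intervalIntegral.integral_Iic_add_Ioi (b := 0) hmi.integrableOn hmi.integrableOn
  have hneg := integral_comp_neg_Ioi 0 m
  rw [neg_zero] at hneg
  rw [← hneg, add_comm, ← integral_add hmi.integrableOn hmi.comp_neg.integrableOn] at hsplit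
  have hfin : (∫ y in Ioi (0 : ℝ), (((y / (a ^ 2 + y ^ 2) : ℝ) : ℂ) * φ y -
      ((y / (a ^ 2 + y ^ 2) : ℝ) : ℂ) * φ (-y))) = ∫ y, m y := by
    rw [← hsplit]
    refine integral_congr_ae (.of_forall fun y => ?_)
    simp only [hm, neg_sq, neg_div]
    push_cast
    ring
  rw [hfin, ← neg_mul, ← integral_const_mul]
  refine integral_congr_ae (.of_forall fun y => ?_)
  simpa using hpt y

lemma abs_div_sq_add_sq_le (a : ℝ) {y : ℝ} (hy : 0 < y) : |y / (a ^ 2 + y ^ 2)| ≤ y⁻¹ := by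
  rw [abs_of_pos (by positivity), div_le_iff₀ (by positivity), inv_mul_eq_div, le_div_iff₀ hy]
  nlinarith [sq_nonneg a]

/-- The Laplace transform of the odd part of the Fourier transform, at the origin. -/
lemma integral_fourierT_sub (φ : SchwartzMap ℝ ℂ) :
    ∫ x in Ioi (0 : ℝ), (fourierTSchwartz φ x - fourierTSchwartz φ (-x)) =
      -2 * Complex.I * ∫ y in Ioi (0 : ℝ), ((y⁻¹ : ℝ) : ℂ) * (φ y - φ (-y)) := by
  have hL : Tendsto (fun a : ℝ => ∫ x in Ioi (0 : ℝ), (Real.exp (-a * x) : ℂ) *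
      (fourierTSchwartz φ x - fourierTSchwartz φ (-x))) (𝓝[>] 0)
      (𝓝 (∫ x in Ioi (0 : ℝ), (fourierTSchwartz φ x - fourierTSchwartz φ (-x)))) := by
    have hint := (fourierTSchwartz φ).integrable_sub_comp_neg
    refine tendsto_integral_filter_of_dominated_convergence
      (fun x => ‖fourierTSchwartz φ x - fourierTSchwartz φ (-x)‖)
      (.of_forall fun a => ?_) ?_ hint.norm.integrableOn (.of_forall fun x => ?_)
    · exact (by fun_prop : AEStronglyMeasurable (fun x : ℝ => (Real.exp (-a * x) : ℂ)) _).mul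
        hint.aestronglyMeasurable.restrict
    · filter_upwards [self_mem_nhdsWithin] with a ha
      filter_upwards [ae_restrict_mem measurableSet_Ioi] with x hx
      have ha : 0 < a := ha
      have hx : 0 < x := hx
      rw [norm_mul]
      refine mul_le_of_le_one_left (norm_nonneg _) ?_
      rw [Complex.norm_real, Real.norm_eq_abs, abs_of_pos (Real.exp_pos _), Real.exp_le_one_iff]
      nlinarith
    · have hc : Continuous (fun a : ℝ => (Real.exp (-a * x) : ℂ) *
          (fourierTSchwartz φ x - fourierTSchwartz φ (-x))) := by fun_prop
      simpa using (hc.tendsto 0).mono_left nhdsWithin_le_nhds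
  have hR : Tendsto (fun a : ℝ => ∫ y in Ioi (0 : ℝ), ((y / (a ^ 2 + y ^ 2) : ℝ) : ℂ) *
      (φ y - φ (-y))) (𝓝[>] 0)
      (𝓝 (∫ y in Ioi (0 : ℝ), ((y⁻¹ : ℝ) : ℂ) * (φ y - φ (-y)))) := by
    refine tendsto_integral_filter_of_dominated_convergence
      (fun y => ‖((y⁻¹ : ℝ) : ℂ) * (φ y - φ (-y))‖)
      (.of_forall fun a => ?_) (.of_forall fun a => ?_)
      φ.integrableOn_inv_mul_sub_comp_neg.norm ?_
    · refine AEStronglyMeasurable.mul (Measurable.aestronglyMeasurable ?_)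
        φ.integrable_sub_comp_neg.aestronglyMeasurable.restrict
      fun_prop
    · filter_upwards [ae_restrict_mem measurableSet_Ioi] with y hy
      have hy : 0 < y := hy
      rw [norm_mul, norm_mul, Complex.norm_real, Complex.norm_real, Real.norm_eq_abs,
        Real.norm_eq_abs, abs_of_pos (inv_pos.2 hy)]
      gcongr
      exact abs_div_sq_add_sq_le a hy
    · filter_upwards [ae_restrict_mem measurableSet_Ioi] with y hy
      have hy : 0 < y := hy
      have hc : Continuous (fun a : ℝ => y / (a ^ 2 + y ^ 2)) :=
        continuous_const.div (by fun_prop) fun a => by positivity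
      have h := (hc.tendsto 0).mono_left (nhdsWithin_le_nhds (s := Ioi 0))
      have e : y / (0 ^ 2 + y ^ 2) = y⁻¹ := by field_simp; simp
      rw [e] at h
      exact ((Complex.continuous_ofReal.tendsto _).comp h).mul_const _
  refine tendsto_nhds_unique hL ((hR.const_mul (-2 * Complex.I)).congr' ?_)
  filter_upwards [self_mem_nhdsWithin] with a ha
  exact (integral_exp_mul_fourierT_sub φ ha).symm

/-- Termwise integration of a series of nonnegative kernels whose sum has at most a simple pole
at the origin, against the odd part of a Schwartz function. -/
lemma SchwartzMap.hasSum_integral_mul_sub_comp_neg (ψ : SchwartzMap ℝ ℂ) {k : ℕ → ℝ → ℝ}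
    {K : ℝ → ℝ} (hk : ∀ n, Measurable (k n)) (hk0 : ∀ n x, 0 < x → 0 ≤ k n x)
    (hsum : ∀ x, 0 < x → HasSum (fun n => k n x) (K x))
    (hK : IntegrableOn (fun x : ℝ => (K x : ℂ) * (ψ x - ψ (-x))) (Ioi 0)) :
    HasSum (fun n => ∫ x in Ioi (0 : ℝ), (k n x : ℂ) * (ψ x - ψ (-x)))
      (∫ x in Ioi (0 : ℝ), (K x : ℂ) * (ψ x - ψ (-x))) := by
  refine hasSum_integral_of_dominated_convergence
    (fun n x => k n x * ‖ψ x - ψ (-x)‖) (fun n => ?_) (fun n => ?_) ?_ ?_ ?_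
  · exact (Complex.measurable_ofReal.comp (hk n)).aestronglyMeasurable.mul
      ψ.integrable_sub_comp_neg.aestronglyMeasurable.restrict
  · filter_upwards [ae_restrict_mem measurableSet_Ioi] with x hx
    rw [norm_mul, Complex.norm_real, Real.norm_eq_abs, abs_of_nonneg (hk0 n x hx)]
  · filter_upwards [ae_restrict_mem measurableSet_Ioi] with x hx
    exact ((hsum x hx).mul_right _).summable
  · refine hK.norm.congr ?_
    filter_upwards [ae_restrict_mem measurableSet_Ioi] with x hx
    rw [((hsum x hx).mul_right _).tsum_eq, norm_mul, Complex.norm_real, Real.norm_eq_abs,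
      abs_of_nonneg ((hsum x hx).nonneg fun n => hk0 n x hx)]
  · filter_upwards [ae_restrict_mem measurableSet_Ioi] with x hx
    exact ((Complex.hasSum_ofReal.2 (hsum x hx))).mul_right _

/-- The hyperbolic cotangent is, up to a factor and scaling, its own Fourier transform. -/
lemma integral_realCoth_mul_fourierT_sub {β : ℝ} (hβ : 0 < β) (φ : SchwartzMap ℝ ℂ) :
    ∫ x in Ioi (0 : ℝ), (realCoth (β / 2 * x) : ℂ) *
        (fourierTSchwartz φ x - fourierTSchwartz φ (-x)) =
      -2 * Complex.I * (π / β) * ∫ y in Ioi (0 : ℝ), (realCoth (π / β * y) : ℂ) *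
        (φ y - φ (-y)) := by
  have hψ1 := (fourierTSchwartz φ).integrableOn_realCoth_mul_sub_comp_neg (half_pos hβ)
  have hψ0 := (fourierTSchwartz φ).integrable_sub_comp_neg.integrableOn (s := Ioi 0)
  have hφ1 := φ.integrableOn_realCoth_mul_sub_comp_neg (div_pos Real.pi_pos hβ)
  have hφ0 := φ.integrableOn_inv_mul_sub_comp_neg
  have eL : (fun x : ℝ => (((realCoth (β / 2 * x) - 1) / 2 : ℝ) : ℂ) *
      (fourierTSchwartz φ x - fourierTSchwartz φ (-x))) = fun x =>
      (1 / 2 : ℂ) * ((realCoth (β / 2 * x) : ℂ) *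
      (fourierTSchwartz φ x - fourierTSchwartz φ (-x)) -
        (fourierTSchwartz φ x - fourierTSchwartz φ (-x))) := by
    funext x
    push_cast
    ring
  have eR : (fun y : ℝ => (((π / β * realCoth (π / β * y) - y⁻¹) / 2 : ℝ) : ℂ) *
      (φ y - φ (-y))) = fun y => (1 / 2 : ℂ) * ((π / β : ℂ) * ((realCoth (π / β * y) : ℂ) *
      (φ y - φ (-y))) - ((y⁻¹ : ℝ) : ℂ) * (φ y - φ (-y))) := by
    funext x
    push_cast
    ring
  have sL := (fourierTSchwartz φ).hasSum_integral_mul_sub_comp_neg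
    (k := fun n x => Real.exp (-((n + 1) * β) * x))
    (K := fun x => (realCoth (β / 2 * x) - 1) / 2)
    (fun n => by fun_prop) (fun n x _ => (Real.exp_pos _).le)
    (fun x hx => by simpa [mul_div_right_comm] using hasSum_exp_realCoth hβ hx)
    (by rw [eL]; exact (hψ1.sub hψ0).const_mul _)
  have sR := φ.hasSum_integral_mul_sub_comp_neg
    (k := fun n y => y / (((n + 1) * β) ^ 2 + y ^ 2))
    (K := fun y => (π / β * realCoth (π / β * y) - y⁻¹) / 2)
    (fun n => by fun_prop) (fun n y hy => by positivity)
    (fun y hy => by simpa [mul_div_right_comm] using hasSum_div_sq_add_sq_realCoth hβ hy)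
    (by rw [eR]; exact ((hφ1.const_mul _).sub hφ0).const_mul _)
  have sR' := sR.mul_left (-2 * Complex.I)
  have hterm : ∀ n : ℕ, ∫ x in Ioi (0 : ℝ), (Real.exp (-((n + 1) * β) * x) : ℂ) *
        (fourierTSchwartz φ x - fourierTSchwartz φ (-x)) =
      -2 * Complex.I * ∫ y in Ioi (0 : ℝ), ((y / (((n + 1) * β) ^ 2 + y ^ 2) : ℝ) : ℂ) *
        (φ y - φ (-y)) := fun n => integral_exp_mul_fourierT_sub φ (by positivity)
  simp only [hterm] at sL
  have key := sL.unique sR'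
  rw [eL, eR, integral_const_mul, integral_const_mul, integral_sub hψ1 hψ0,
    integral_sub (hφ1.const_mul _) hφ0, integral_const_mul, integral_fourierT_sub] at key
  linear_combination 2 * key

lemma inv_exp_sub_one {β x : ℝ} (hβ : 0 < β) (hx : x ≠ 0) :
    (Real.exp (β * x) - 1)⁻¹ = (realCoth (β / 2 * x) - 1) / 2 := by
  rw [realCoth_eq_one_add (by positivity), show 2 * (β / 2 * x) = β * x by ring]
  ring

/-- Distributional Fourier transform of the Bose–Einstein function: for `β > 0`,
`Vp ∫ φ̂(x)/(e^{βx}−1) dx = −π φ(0) + Vp ∫ (π/(iβ))·coth(πx/β) φ(x) dx`,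
both principal-value limits existing. -/
theorem fourier_bose_einstein (β : ℝ) (hβ : 0 < β) (φ : SchwartzMap ℝ ℂ) :
    ∃ L pv : ℂ,
      Tendsto
        (fun ε : ℝ => ∫ x in {x : ℝ | ε < |x|},
          fourierT φ x / ((Real.exp (β * x) - 1 : ℝ) : ℂ))
        (nhdsWithin 0 (Set.Ioi 0)) (nhds L) ∧
      Tendsto
        (fun ε : ℝ => ∫ x in {x : ℝ | ε < |x|},
          ((π : ℂ) / (Complex.I * (β : ℂ)) *
            ((Real.cosh (π * x / β) / Real.sinh (π * x / β) : ℝ) : ℂ)) * φ x)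
        (nhdsWithin 0 (Set.Ioi 0)) (nhds pv) ∧
      L = -(π : ℂ) * φ 0 + pv := by
  set ψ := fourierTSchwartz φ with hψ
  have hpv := φ.tendsto_setIntegral_realCoth (div_pos Real.pi_pos hβ)
  have hL := (ψ.tendsto_setIntegral_realCoth (half_pos hβ)).sub
    (tendsto_setIntegral_lt_abs_of_integrable ψ.integrable)
  refine ⟨_, _, (hL.const_mul (1 / 2 : ℂ)).congr' ?_,
    (hpv.const_mul ((π : ℂ) / (Complex.I * (β : ℂ)))).congr fun ε => ?_, ?_⟩
  · filter_upwards [self_mem_nhdsWithin] with ε hε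
    have hε : 0 < ε := hε
    rw [← integral_sub (ψ.integrableOn_realCoth_mul (half_pos hβ) hε) ψ.integrable.integrableOn,
      ← integral_const_mul]
    refine setIntegral_congr_fun (measurableSet_lt measurable_const measurable_id.abs)
      fun x hx => ?_
    have hx0 : x ≠ 0 := abs_pos.1 (hε.trans hx)
    rw [← fourierTSchwartz_apply, ← hψ, div_eq_mul_inv (ψ x), ← Complex.ofReal_inv,
      inv_exp_sub_one hβ hx0]
    push_cast
    ring
  · rw [← integral_const_mul]
    refine integral_congr_ae (.of_forall fun x => ?_)
    simp only [realCoth]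
    rw [div_mul_eq_mul_div π β x]
    ring
  · rw [hψ, integral_realCoth_mul_fourierT_sub hβ, integral_fourierTSchwartz]
    rw [← div_div, Complex.div_I]
    ring
end
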